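/- Let a, b > 0, n ∈ ℤ with n ≥ 1, and 0 < h < a, and let [Δ, ((a,h)), (+1)] be the minimal semitoric polygon of type (3a): Δ has vertices (0,0), (a,a), (a+b,a), (na+b,0), with marked point (a,h) and upward cut. Then the semitoric packing density is: ρ_ST = 2a/(na+2b) if n > 1; ρ_ST = 2a/(a+2b) if n = 1 and a ≤ b; ρ_ST = (a² + b² + (a−b)²)/((a+2b)a) if n = 1 and b < a < 2b; and ρ_ST = (a² + 2b²)/((a+2b)a) if n = 1 and a ≥ 2b. In particular ρ_ST is independent of h. -/

import Mathlib

open Matrix MeasureTheory Set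

/-- Points of the plane. -/
abbrev Pt := Fin 2 → ℝ

/-- The action of `SL₂(ℤ)` on `ℝ²` by matrix-vector multiplication. -/
noncomputable def sl2Apply (M : Matrix.SpecialLinearGroup (Fin 2) ℤ) (x : Pt) : Pt :=
  ((M : Matrix (Fin 2) (Fin 2) ℤ).map (Int.cast : ℤ → ℝ)).mulVec x

/-- The model triangle `B(λ) = {(x,y) : x ≥ 0, y ≥ 0, x + y < λ}`. -/
def modelTriangle (lam : ℝ) : Set Pt :=
  {x | 0 ≤ x 0 ∧ 0 ≤ x 1 ∧ x 0 + x 1 < lam}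

/-- The area (Lebesgue measure) of a subset of the plane. -/
noncomputable def area (S : Set Pt) : ℝ := (volume S).toReal

/-- The element of the group `𝒯 × G_m` determined by a global power `n` of
`T = [[1,0],[1,1]]`, a vertical translation `t`, and cut flips `u` (with `u j ∈ {0, ε_j}`;
flipping the cut at the marked point `c j` applies `T^{± 1}` on the half-plane to its
right), as a piecewise affine map of the plane. -/
noncomputable def stMap {m : ℕ} (c : Fin m → Pt) (n : ℤ) (t : ℝ) (u : Fin m → ℤ)
    (x : Pt) : Pt :=
  ![x 0, x 1 + (n : ℝ) * x 0 + t + ∑ j, (u j : ℝ) * max (x 0 - c j 0) 0]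

/-- `B` is an admissibly packed triangle of `SL₂(ℤ)`-size `lam` at the point `p` of the
semitoric polygon with underlying set `Δ`, marked points `c` and cut directions `eps`:
in some equivalent representative (image under an element `σ` of `𝒯 × G_m`), `σ(B)` has
the form `M(B(lam)) + σ(p)` with `M ∈ SL₂(ℤ)`, coincides with the polygon near `σ(p)`,
and contains no marked point. -/
def IsSTPackedTriangleIn {m : ℕ} (Δ : Set Pt) (c : Fin m → Pt) (eps : Fin m → ℤ)
    (p : Pt) (lam : ℝ) (B : Set Pt) : Prop :=
  0 < lam ∧ B ⊆ Δ ∧ (∀ j, c j ∉ B) ∧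
  ∃ (n : ℤ) (t : ℝ) (u : Fin m → ℤ), (∀ j, u j = 0 ∨ u j = eps j) ∧
    (∃ M : Matrix.SpecialLinearGroup (Fin 2) ℤ,
        stMap c n t u '' B =
          (fun x => sl2Apply M x + stMap c n t u p) '' modelTriangle lam) ∧
    ∃ U : Set Pt, IsOpen U ∧ stMap c n t u p ∈ U ∧
      (stMap c n t u '' B) ∩ U = (stMap c n t u '' Δ) ∩ U

/-- `P` is a semitoric packing of the semitoric polygon `(Δ, c, eps)`: a finite union of
pairwise disjoint admissibly packed triangles, at most one at each vertex. -/
def IsSTPackingIn {m : ℕ} (Δ : Set Pt) (c : Fin m → Pt) (eps : Fin m → ℤ)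
    (P : Set Pt) : Prop :=
  ∃ (N : ℕ) (pt : Fin N → Pt) (lam : Fin N → ℝ) (tri : Fin N → Set Pt),
    P = (⋃ a, tri a) ∧ Function.Injective pt ∧
    (∀ a, pt a ∈ Set.extremePoints ℝ Δ) ∧
    (∀ a, IsSTPackedTriangleIn Δ c eps (pt a) (lam a) (tri a)) ∧
    Pairwise (Function.onFun Disjoint tri)

/-- The set of densities `area P / area Δ` of semitoric packings `P` of `(Δ, c, eps)`;
the semitoric packing density `ρ_ST` is its supremum. -/
def stDensitySet {m : ℕ} (Δ : Set Pt) (c : Fin m → Pt) (eps : Fin m → ℤ) : Set ℝ :=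
  {r : ℝ | ∃ P, IsSTPackingIn Δ c eps P ∧ r = area P / area Δ}


theorem sq_add_sq_le {x y a : ℝ} (hx : 0 ≤ x) (hy : 0 ≤ y) (h : x + y ≤ a) :
    x ^ 2 + y ^ 2 ≤ a ^ 2 := by nlinarith [mul_nonneg hx hy]

theorem sum_sq_le_of_lt_two_mul {a b x y z w : ℝ} (hba : b < a)
    (hx : 0 ≤ x) (hy : 0 ≤ y) (hz : 0 ≤ z) (hw : 0 ≤ w)
    (hxw : x + w ≤ a) (hyz : y + z ≤ a) (hxz : x + z ≤ a + b) (hyw : y + w ≤ b) (hab : a < 2 * b) :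
    x ^ 2 + y ^ 2 + z ^ 2 + w ^ 2 ≤ a ^ 2 + b ^ 2 + (a - b) ^ 2 := by
  rcases le_total (x - y) (a - b) with h1 | h1
  · have h4 : w ^ 2 ≤ (b - y) ^ 2 := by gcongr; linarith
    rcases le_total (x - y) b with h2 | h2
    · have h3 : z ^ 2 ≤ (a - y) ^ 2 := by gcongr; linarith
      nlinarith [mul_nonneg hx hy, mul_nonneg hy (sub_nonneg.2 h1), mul_nonneg hx (sub_nonneg.2
        h1), mul_nonneg hy (by linarith : 0 ≤ b - y), mul_nonneg hx (by linarith : 0 ≤ b - y),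
        mul_nonneg (sub_nonneg.2 h1) (by linarith : 0 ≤ b - y)]
    · linarith
  · have h4 : w ^ 2 ≤ (a - x) ^ 2 := by gcongr; linarith
    rcases le_total (x - y) b with h2 | h2
    · have h3 : z ^ 2 ≤ (a - y) ^ 2 := by gcongr; linarith
      nlinarith [mul_nonneg (sub_nonneg.2 h1) (sub_nonneg.2 h2), mul_nonneg hy (sub_nonneg.2 h1),
        mul_nonneg hy (sub_nonneg.2 h2), mul_nonneg hy (by linarith : 0 ≤ a - x), mul_nonneg
        (sub_nonneg.2 h1) (by linarith : 0 ≤ a - x), mul_nonneg (sub_nonneg.2 h2) (by linarith : 0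
        ≤ a - x), mul_nonneg (sub_nonneg.2 h2) (by linarith : 0 ≤ b - y), mul_nonneg (by linarith :
        0 ≤ a - x) (by linarith : 0 ≤ b - y), mul_nonneg hy (by linarith : 0 ≤ b - y)]
    · have h3 : z ^ 2 ≤ (a + b - x) ^ 2 := by gcongr; linarith
      nlinarith [mul_nonneg hy (sub_nonneg.2 h2), mul_nonneg hy (by linarith : 0 ≤ a - x),
        mul_nonneg (sub_nonneg.2 h2) (by linarith : 0 ≤ a - x), mul_nonneg (sub_nonneg.2 h2) (by
        linarith : 0 ≤ b - y), mul_nonneg (by linarith : 0 ≤ a - x) (by linarith : 0 ≤ b - y),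
        mul_nonneg hy (by linarith : 0 ≤ b - y)]

theorem sum_sq_le_of_two_mul_le {a b x y z w : ℝ} (hb : 0 < b)
    (hx : 0 ≤ x) (hy : 0 ≤ y) (hz : 0 ≤ z) (hw : 0 ≤ w)
    (hxw : x + w ≤ a) (hyz : y + z ≤ a) (hxz : x + z ≤ a + b) (hyw : y + w ≤ b) (hab : 2 * b ≤ a) :
    x ^ 2 + y ^ 2 + z ^ 2 + w ^ 2 ≤ a ^ 2 + 2 * b ^ 2 := by
  rcases le_total (x - y) (a - b) with h1 | h1
  · have h4 : w ^ 2 ≤ (b - y) ^ 2 := by gcongr; linarith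
    rcases le_total (x - y) b with h2 | h2
    · have h3 : z ^ 2 ≤ (a - y) ^ 2 := by gcongr; linarith
      nlinarith [mul_nonneg hx hy, mul_nonneg hy (sub_nonneg.2 h1), mul_nonneg hx (sub_nonneg.2
        h1), mul_nonneg hy (by linarith : 0 ≤ b - y), mul_nonneg hx (by linarith : 0 ≤ b - y),
        mul_nonneg (sub_nonneg.2 h1) (by linarith : 0 ≤ b - y), mul_nonneg hx (sub_nonneg.2 h2),
        mul_nonneg hy (sub_nonneg.2 h2), mul_nonneg (sub_nonneg.2 h2) (by linarith : 0 ≤ b - y)]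
    · have h3 : z ^ 2 ≤ (a + b - x) ^ 2 := by gcongr; linarith
      nlinarith [mul_nonneg hy (sub_nonneg.2 h1), mul_nonneg hy (sub_nonneg.2 h2), mul_nonneg hy
        (by linarith : 0 ≤ b - y), mul_nonneg (sub_nonneg.2 h1) (sub_nonneg.2 h2), mul_nonneg
        (sub_nonneg.2 h1) (by linarith : 0 ≤ b - y), mul_nonneg (sub_nonneg.2 h2) (by linarith : 0
        ≤ b - y)]
  · have h4 : w ^ 2 ≤ (a - x) ^ 2 := by gcongr; linarith
    rcases le_total (x - y) b with h2 | h2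
    · nlinarith
    · have h3 : z ^ 2 ≤ (a + b - x) ^ 2 := by gcongr; linarith
      nlinarith [mul_nonneg hy (sub_nonneg.2 h1), mul_nonneg hy (by linarith : 0 ≤ a - x),
        mul_nonneg (sub_nonneg.2 h1) (by linarith : 0 ≤ a - x), mul_nonneg (sub_nonneg.2 h1) (by
        linarith : 0 ≤ b - y), mul_nonneg (by linarith : 0 ≤ a - x) (by linarith : 0 ≤ b - y),
        mul_nonneg hy (by linarith : 0 ≤ b - y)]

theorem sum_sq_le_of_ge_of_lt_two_mul {a b x y z : ℝ}
    (hx : 0 ≤ x) (hz : 0 ≤ z) (hby : b ≤ y)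
    (hyz : y + z ≤ a) (hxy : x + y ≤ a + b) :
    x ^ 2 + y ^ 2 + z ^ 2 ≤ a ^ 2 + b ^ 2 + (a - b) ^ 2 := by
  have h3 : z ^ 2 ≤ (a - y) ^ 2 := by gcongr; linarith
  have h4 : x ^ 2 ≤ (a + b - y) ^ 2 := by gcongr; linarith
  nlinarith [mul_nonneg (sub_nonneg.2 hby) (by linarith : 0 ≤ a - y)]

theorem sum_sq_le_of_ge_of_two_mul_le {a b x y z : ℝ} (hb : 0 < b)
    (hx : 0 ≤ x) (hz : 0 ≤ z) (hby : b ≤ y)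
    (hyz : y + z ≤ a) (hxz : x + z ≤ a + b) (hxy : x + y ≤ a + b) :
    x ^ 2 + y ^ 2 + z ^ 2 ≤ a ^ 2 + 2 * b ^ 2 := by
  rcases le_total z y with h | h
  · have h3 : x ^ 2 ≤ (a + b - y) ^ 2 := by gcongr; linarith
    have h0 : 0 ≤ a - y - z := by linarith
    nlinarith [mul_nonneg hz h0, mul_nonneg h0 (sub_nonneg.2 h), mul_nonneg hz (sub_nonneg.2 h),
      mul_nonneg (sub_nonneg.2 hby) hz, mul_nonneg (sub_nonneg.2 hby) h0, mul_nonneg (sub_nonneg.2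
      hby) (sub_nonneg.2 h), sq_nonneg (a - 2 * b)]
  · have h3 : x ^ 2 ≤ (a + b - z) ^ 2 := by gcongr; linarith
    have h0 : 0 ≤ a - y - z := by linarith
    nlinarith [mul_nonneg (sub_nonneg.2 hby) h0, mul_nonneg h0 (sub_nonneg.2 h), mul_nonneg
      (sub_nonneg.2 hby) (sub_nonneg.2 h)]

open Filter Topology

/-- The second coordinate of the piecewise affine map which multiplies the half-plane
`x 0 ≥ a` by `T ^ u`. -/
noncomputable def flipHeight (a : ℝ) (u : ℤ) (x : Pt) : ℝ := x 1 + u * max (x 0 - a) 0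

theorem flipHeight_of_le {a : ℝ} {u : ℤ} {x : Pt} (hx : x 0 ≤ a) : flipHeight a u x = x 1 := by
  simp [flipHeight, max_eq_right (sub_nonpos.2 hx)]

theorem flipHeight_of_ge {a : ℝ} {u : ℤ} {x : Pt} (hx : a ≤ x 0) :
    flipHeight a u x = x 1 + u * (x 0 - a) := by
  simp [flipHeight, max_eq_left (sub_nonneg.2 hx)]

@[fun_prop]
theorem continuous_flipHeight (a : ℝ) (u : ℤ) : Continuous (flipHeight a u) := by
  unfold flipHeight
  fun_prop

theorem stMap_eq (a h : ℝ) (n : ℤ) (t : ℝ) (u : Fin 1 → ℤ) (x : Pt) :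
    stMap ![![a, h]] n t u x = ![x 0, flipHeight a (u 0) x + n * x 0 + t] := by
  ext i
  fin_cases i <;> simp [stMap, flipHeight]
  ring

theorem sl2Apply_zero (M : Matrix.SpecialLinearGroup (Fin 2) ℤ) (x : Pt) :
    sl2Apply M x 0 = M 0 0 * x 0 + M 0 1 * x 1 := by
  simp [sl2Apply, Matrix.mulVec, dotProduct, Fin.sum_univ_two]

theorem sl2Apply_one (M : Matrix.SpecialLinearGroup (Fin 2) ℤ) (x : Pt) :
    sl2Apply M x 1 = M 1 0 * x 0 + M 1 1 * x 1 := by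
  simp [sl2Apply, Matrix.mulVec, dotProduct, Fin.sum_univ_two]

/-- Integral affine coordinates on a packed triangle: in the coordinates `x 0` and `flipHeight`,
the triangle is a unimodular copy of the model triangle, and near its vertex it coincides with
the polygon. -/
theorem IsSTPackedTriangleIn.exists_coords {a h lam : ℝ} {Δ B : Set Pt} {P : Pt}
    (H : IsSTPackedTriangleIn Δ ![![a, h]] ![1] P lam B) :
    ∃ u : ℤ, (u = 0 ∨ u = 1) ∧ ∃ p q r s : ℤ, p * s - q * r = 1 ∧
      (∀ x : Pt, x ∈ B ↔
        0 ≤ p * (x 0 - P 0) + q * (flipHeight a u x - flipHeight a u P) ∧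
        0 ≤ r * (x 0 - P 0) + s * (flipHeight a u x - flipHeight a u P) ∧
        (p * (x 0 - P 0) + q * (flipHeight a u x - flipHeight a u P)) +
          (r * (x 0 - P 0) + s * (flipHeight a u x - flipHeight a u P)) < lam) ∧
      ∀ᶠ x in 𝓝 P, x ∈ B ↔ x ∈ Δ := by
  obtain ⟨hlam, -, -, n, t, u, hu, ⟨M, hM⟩, U, hUo, hPU, hU⟩ := H
  have hdet : M 0 0 * M 1 1 - M 0 1 * M 1 0 = 1 := by
    rw [← Matrix.det_fin_two]; exact M.2
  have hdetR : (M 0 0 : ℝ) * M 1 1 - M 0 1 * M 1 0 = 1 := by exact_mod_cast hdet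
  have hinj : Function.Injective (stMap ![![a, h]] n t u) := by
    intro x y hxy
    rw [stMap_eq, stMap_eq] at hxy
    have h0 : x 0 = y 0 := by simpa using congrFun hxy 0
    have h1 := congrFun hxy 1
    simp only [flipHeight, h0, Matrix.cons_val_one, Matrix.cons_val_fin_one] at h1
    ext i
    fin_cases i
    · exact h0
    · simpa using h1
  have hcont : Continuous (stMap ![![a, h]] n t u) := by
    have : stMap ![![a, h]] n t u =
        fun x : Pt => ![x 0, flipHeight a (u 0) x + n * x 0 + t] := funext (stMap_eq a h n t u)
    rw [this]
    fun_prop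
  refine ⟨u 0, by simpa using hu 0, M 1 1 - M 0 1 * n, -M 0 1, -M 1 0 + M 0 0 * n, M 0 0,
    by linarith, fun x => ?_, ?_⟩
  · rw [← hinj.mem_set_image, hM]
    push_cast
    constructor
    · rintro ⟨z, ⟨hz0, hz1, hz⟩, hzx⟩
      rw [stMap_eq, stMap_eq] at hzx
      have e0 := congrFun hzx 0
      have e1 := congrFun hzx 1
      simp only [Pi.add_apply, sl2Apply_zero, sl2Apply_one, Matrix.cons_val_zero,
        Matrix.cons_val_one, Matrix.cons_val_fin_one] at e0 e1
      have k0 : (M 1 1 - M 0 1 * n : ℝ) * (x 0 - P 0) +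
          -M 0 1 * (flipHeight a (u 0) x - flipHeight a (u 0) P) = z 0 := by
        linear_combination z 0 * hdetR - (M 1 1 : ℝ) * e0 + (M 0 1 : ℝ) * e1
      have k1 : (-M 1 0 + M 0 0 * n : ℝ) * (x 0 - P 0) +
          M 0 0 * (flipHeight a (u 0) x - flipHeight a (u 0) P) = z 1 := by
        linear_combination z 1 * hdetR + (M 1 0 : ℝ) * e0 - (M 0 0 : ℝ) * e1
      rw [k0, k1]
      exact ⟨hz0, hz1, hz⟩
    · rintro ⟨hz0, hz1, hz⟩
      refine ⟨![_, _], ⟨hz0, hz1, hz⟩, ?_⟩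
      rw [stMap_eq, stMap_eq]
      ext i
      fin_cases i
      · simp [sl2Apply_zero]
        linear_combination (x 0 - P 0) * hdetR
      · simp [sl2Apply_one]
        linear_combination (flipHeight a (u 0) x - flipHeight a (u 0) P + n * (x 0 - P 0)) * hdetR
  · filter_upwards [hcont.continuousAt.preimage_mem_nhds (hUo.mem_nhds hPU)] with x hx
    have := Set.ext_iff.1 hU (stMap ![![a, h]] n t u x)
    simp only [mem_inter_iff, hinj.mem_set_image] at this
    have hx' : stMap ![![a, h]] n t u x ∈ U := hx
    tauto

theorem measurePreserving_coords (a : ℝ) (u : ℤ) (P : Pt) {p q r s : ℤ}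
    (hdet : p * s - q * r = 1) :
    MeasurePreserving (fun x : Pt =>
      (![p * (x 0 - P 0) + q * (flipHeight a u x - flipHeight a u P),
        r * (x 0 - P 0) + s * (flipHeight a u x - flipHeight a u P)] : Pt)) := by
  have h1 : MeasurePreserving (fun x : Pt => (![x 0, flipHeight a u x] : Pt)) := by
    have hs : MeasurePreserving (fun z : ℝ × ℝ => (z.1, z.2 + u * max (z.1 - a) 0)) :=
      (MeasurePreserving.id volume).skew_product (g := fun y z => z + u * max (y - a) 0)
        (by unfold Function.uncurry; fun_prop)
        (ae_of_all _ fun y => (measurePreserving_add_right volume _).map_eq)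
    have e := volume_preserving_finTwoArrow ℝ
    exact (e.symm _).comp (hs.comp e)
  have h2 : MeasurePreserving (fun x : Pt => x - ![P 0, flipHeight a u P]) :=
    measurePreserving_sub_right volume _
  have h3 : MeasurePreserving (Matrix.toLin' (!![(p : ℝ), q; r, s])) := by
    have hd : (!![(p : ℝ), q; r, s]).det = 1 := by
      rw [Matrix.det_fin_two_of]; exact_mod_cast hdet
    refine ⟨(LinearMap.continuous_of_finiteDimensional _).measurable, ?_⟩
    rw [Real.map_matrix_volume_pi_eq_smul_volume_pi (by rw [hd]; exact one_ne_zero), hd]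
    simp
  convert h3.comp (h2.comp h1) using 1
  ext x i
  fin_cases i <;> simp [Matrix.mulVec, dotProduct, Fin.sum_univ_two]

theorem measurableSet_modelTriangle (lam : ℝ) : MeasurableSet (modelTriangle lam) := by
  unfold modelTriangle
  measurability

/-- The area under slices by horizontal lines. -/
theorem volume_eq_lintegral_slice {S : Set Pt} (hS : MeasurableSet S) :
    volume S = ∫⁻ y, volume {x : ℝ | ![x, y] ∈ S} := by
  have e := (volume_preserving_finTwoArrow ℝ).symm
  rw [← e.measure_preimage_equiv S, Measure.volume_eq_prod,
    Measure.prod_apply_symm (e.measurable hS)]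
  rfl

theorem volume_modelTriangle {lam : ℝ} (hlam : 0 ≤ lam) :
    volume (modelTriangle lam) = ENNReal.ofReal (lam ^ 2 / 2) := by
  rw [volume_eq_lintegral_slice (measurableSet_modelTriangle lam)]
  have hslice : ∀ y : ℝ, volume {x : ℝ | ![x, y] ∈ modelTriangle lam} =
      (Icc 0 lam).indicator (fun y => ENNReal.ofReal (lam - y)) y := by
    intro y
    by_cases hy : y ∈ Icc 0 lam
    · rw [indicator_of_mem hy]
      have : {x : ℝ | ![x, y] ∈ modelTriangle lam} = Ico 0 (lam - y) := by
        ext x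
        simp only [modelTriangle, mem_ofPred_eq, Matrix.cons_val_zero, Matrix.cons_val_one,
          Matrix.cons_val_fin_one, mem_Ico, lt_sub_iff_add_lt]
        exact ⟨fun h => ⟨h.1, h.2.2⟩, fun h => ⟨h.1, hy.1, h.2⟩⟩
      rw [this, Real.volume_Ico, sub_zero]
    · rw [indicator_of_notMem hy]
      have : {x : ℝ | ![x, y] ∈ modelTriangle lam} = ∅ := by
        ext x
        simp only [modelTriangle, mem_ofPred_eq, Matrix.cons_val_zero, Matrix.cons_val_one,
          Matrix.cons_val_fin_one, mem_empty_iff_false, iff_false]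
        exact fun h => hy ⟨h.2.1, by linarith⟩
      rw [this, measure_empty]
  simp_rw [hslice]
  rw [lintegral_indicator measurableSet_Icc, ← ofReal_integral_eq_lintegral_ofReal]
  · rw [integral_Icc_eq_integral_Ioc, ← intervalIntegral.integral_of_le hlam]
    congr 1
    rw [intervalIntegral.integral_sub (by simp) (by simp), intervalIntegral.integral_const,
      integral_id]
    simp
    ring
  · exact (by fun_prop : Continuous fun y : ℝ => lam - y).integrableOn_Icc
  · exact (ae_restrict_iff' measurableSet_Icc).2 (ae_of_all _ fun y hy => sub_nonneg.2 hy.2)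

theorem IsSTPackedTriangleIn.measurableSet_and_volume {a h lam : ℝ} {Δ B : Set Pt} {P : Pt}
    (H : IsSTPackedTriangleIn Δ ![![a, h]] ![1] P lam B) :
    MeasurableSet B ∧ volume B = ENNReal.ofReal (lam ^ 2 / 2) := by
  obtain ⟨u, -, p, q, r, s, hdet, hB, -⟩ := H.exists_coords
  have hmp := measurePreserving_coords a u P hdet
  have hBeq : B = (fun x : Pt =>
      (![p * (x 0 - P 0) + q * (flipHeight a u x - flipHeight a u P),
        r * (x 0 - P 0) + s * (flipHeight a u x - flipHeight a u P)] : Pt)) ⁻¹'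
        modelTriangle lam := by
    ext x
    rw [hB]
    rfl
  rw [hBeq]
  exact ⟨hmp.measurable (measurableSet_modelTriangle lam), by
    rw [hmp.measure_preimage (measurableSet_modelTriangle lam).nullMeasurableSet,
      volume_modelTriangle H.1.le]⟩

theorem area_iUnion_packed {a h : ℝ} {Δ : Set Pt} {N : ℕ} {pt : Fin N → Pt} {lam : Fin N → ℝ}
    {tri : Fin N → Set Pt}
    (H : ∀ i, IsSTPackedTriangleIn Δ ![![a, h]] ![1] (pt i) (lam i) (tri i))
    (hdisj : Pairwise (Function.onFun Disjoint tri)) :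
    area (⋃ i, tri i) = ∑ i, lam i ^ 2 / 2 := by
  rw [area, measure_iUnion hdisj fun i => (H i).measurableSet_and_volume.1, tsum_fintype,
    ENNReal.toReal_sum fun i _ => by rw [(H i).measurableSet_and_volume.2]; exact
      ENNReal.ofReal_ne_top]
  refine Finset.sum_congr rfl fun i _ => ?_
  rw [(H i).measurableSet_and_volume.2, ENNReal.toReal_ofReal (by positivity)]

/-- The trapezoid of type (3a), in terms of inequalities. -/
def trapezoid (a b : ℝ) (n : ℤ) : Set Pt :=
  {p | 0 ≤ p 1 ∧ p 1 ≤ a ∧ p 1 ≤ p 0 ∧ p 0 + (n - 1) * p 1 ≤ n * a + b}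

theorem convex_trapezoid (a b : ℝ) (n : ℤ) : Convex ℝ (trapezoid a b n) := by
  rintro p ⟨h1, h2, h3, h4⟩ q ⟨k1, k2, k3, k4⟩ s t hs ht hst
  have ht' : t = 1 - s := by linarith
  simp only [trapezoid, mem_ofPred_eq, Pi.add_apply, Pi.smul_apply, smul_eq_mul]
  subst ht'
  refine ⟨by positivity, ?_, ?_, ?_⟩ <;>
    nlinarith [mul_le_mul_of_nonneg_left h2 hs, mul_le_mul_of_nonneg_left k2 ht,
      mul_le_mul_of_nonneg_left h3 hs, mul_le_mul_of_nonneg_left k3 ht,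
      mul_le_mul_of_nonneg_left h4 hs, mul_le_mul_of_nonneg_left k4 ht]

theorem convexHull_eq_trapezoid {a b : ℝ} {n : ℤ} (ha : 0 < a) (hb : 0 < b) (hn : 1 ≤ n) :
    convexHull ℝ {![0, 0], ![a, a], ![a + b, a], ![(n : ℝ) * a + b, 0]} = trapezoid a b n := by
  have hnR : (1 : ℝ) ≤ n := by exact_mod_cast hn
  refine Subset.antisymm (convexHull_min ?_ (convex_trapezoid a b n)) fun p hp => ?_
  · have := mul_le_mul_of_nonneg_right hnR ha.le
    rintro p (rfl | rfl | rfl | rfl) <;>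
      refine ⟨?_, ?_, ?_, ?_⟩ <;>
      simp only [Matrix.cons_val_zero, Matrix.cons_val_one, Matrix.cons_val_fin_one] <;>
      linarith
  · obtain ⟨h1, h2, h3, h4⟩ := hp
    have hconv := convex_convexHull ℝ
      ({![0, 0], ![a, a], ![a + b, a], ![(n : ℝ) * a + b, 0]} : Set Pt)
    have hsub := subset_convexHull ℝ
      ({![0, 0], ![a, a], ![a + b, a], ![(n : ℝ) * a + b, 0]} : Set Pt)
    have hs0 : 0 ≤ p 1 / a := by positivity
    have hs1 : 0 ≤ 1 - p 1 / a := sub_nonneg.2 ((div_le_one ha).2 h2)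
    have hL := hconv (hsub (a := ![0, 0]) (by simp)) (hsub (a := ![a, a]) (by simp)) hs1 hs0
      (by ring)
    have hR := hconv (hsub (a := ![(n : ℝ) * a + b, 0]) (by simp))
      (hsub (a := ![a + b, a]) (by simp)) hs1 hs0 (by ring)
    have hlen : 0 < n * (a - p 1) + b := by
      have : 0 ≤ n * (a - p 1) := mul_nonneg (by linarith) (sub_nonneg.2 h2)
      linarith
    have hmem := hconv hL hR
      (a := (n * a + b - (n - 1) * p 1 - p 0) / (n * (a - p 1) + b))
      (b := (p 0 - p 1) / (n * (a - p 1) + b))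
      (div_nonneg (by linarith) hlen.le) (div_nonneg (by linarith) hlen.le)
      (by rw [← add_div, div_eq_one_iff_eq hlen.ne']; ring)
    convert hmem using 1
    ext i
    fin_cases i
    · simp
      field_simp
      ring
    · simp
      field_simp
      ring

theorem measurableSet_trapezoid (a b : ℝ) (n : ℤ) : MeasurableSet (trapezoid a b n) := by
  unfold trapezoid
  measurability

theorem area_trapezoid {a b : ℝ} {n : ℤ} (ha : 0 < a) (hb : 0 < b) (hn : 1 ≤ n) :
    area (trapezoid a b n) = a * (n * a + 2 * b) / 2 := by
  have hnR : (1 : ℝ) ≤ n := by exact_mod_cast hn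
  have hlen : ∀ y ∈ Icc 0 a, 0 ≤ n * a + b - n * y := fun y hy => by
    have : 0 ≤ n * (a - y) := mul_nonneg (by linarith) (sub_nonneg.2 hy.2)
    linarith
  rw [area, volume_eq_lintegral_slice (measurableSet_trapezoid a b n)]
  have hslice : ∀ y : ℝ, volume {x : ℝ | ![x, y] ∈ trapezoid a b n} =
      (Icc 0 a).indicator (fun y => ENNReal.ofReal (n * a + b - n * y)) y := by
    intro y
    by_cases hy : y ∈ Icc 0 a
    · rw [indicator_of_mem hy]
      have : {x : ℝ | ![x, y] ∈ trapezoid a b n} = Icc y (n * a + b - (n - 1) * y) := by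
        ext x
        simp only [trapezoid, mem_ofPred_eq, Matrix.cons_val_zero, Matrix.cons_val_one,
          Matrix.cons_val_fin_one, mem_Icc, le_sub_iff_add_le]
        exact ⟨fun h => h.2.2, fun h => ⟨hy.1, hy.2, h⟩⟩
      rw [this, Real.volume_Icc]
      congr 1
      ring
    · rw [indicator_of_notMem hy]
      have : {x : ℝ | ![x, y] ∈ trapezoid a b n} = ∅ := by
        ext x
        simp only [trapezoid, mem_ofPred_eq, Matrix.cons_val_zero, Matrix.cons_val_one,
          Matrix.cons_val_fin_one, mem_empty_iff_false, iff_false]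
        exact fun h => hy ⟨h.1, h.2.1⟩
      rw [this, measure_empty]
  simp_rw [hslice]
  have hint : ∫ y in (0 : ℝ)..a, (n * a + b - n * y) = a * (n * a + 2 * b) / 2 := by
    rw [intervalIntegral.integral_sub (by simp) (Continuous.intervalIntegrable (by fun_prop) _ _),
      intervalIntegral.integral_const, intervalIntegral.integral_const_mul, integral_id]
    simp
    ring
  rw [lintegral_indicator measurableSet_Icc, ← ofReal_integral_eq_lintegral_ofReal]
  · rw [integral_Icc_eq_integral_Ioc, ← intervalIntegral.integral_of_le ha.le, hint,
      ENNReal.toReal_ofReal (by positivity)]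
  · exact (by fun_prop : Continuous fun y : ℝ => n * a + b - n * y).integrableOn_Icc
  · exact (ae_restrict_iff' measurableSet_Icc).2 (ae_of_all _ hlen)

/-- A criterion for extreme points: two functionals attaining their minimum at the point
determine it. -/
theorem mem_extremePoints_of_functionals {S : Set Pt} {P : Pt} (hP : P ∈ S) {c d e f : ℝ}
    (hdet : c * f - d * e ≠ 0)
    (h1 : ∀ x ∈ S, c * P 0 + d * P 1 ≤ c * x 0 + d * x 1)
    (h2 : ∀ x ∈ S, e * P 0 + f * P 1 ≤ e * x 0 + f * x 1) :
    P ∈ S.extremePoints ℝ := by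
  rw [mem_extremePoints_iff_left]
  refine ⟨hP, fun x hx y hy ⟨s, t, hs, ht, hst, hxy⟩ => ?_⟩
  have e0 : s * x 0 + t * y 0 = P 0 := by simpa using congrFun hxy 0
  have e1 : s * x 1 + t * y 1 = P 1 := by simpa using congrFun hxy 1
  have k1 : c * x 0 + d * x 1 = c * P 0 + d * P 1 := by
    refine le_antisymm ?_ (h1 x hx)
    have := mul_le_mul_of_nonneg_left (h1 y hy) ht.le
    refine le_of_mul_le_mul_left ?_ hs
    linear_combination this + c * e0 + d * e1 - (c * P 0 + d * P 1) * hst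
  have k2 : e * x 0 + f * x 1 = e * P 0 + f * P 1 := by
    refine le_antisymm ?_ (h2 x hx)
    have := mul_le_mul_of_nonneg_left (h2 y hy) ht.le
    refine le_of_mul_le_mul_left ?_ hs
    linear_combination this + e * e0 + f * e1 - (e * P 0 + f * P 1) * hst
  ext i
  fin_cases i
  · refine mul_left_cancel₀ hdet ?_
    simp only [Fin.zero_eta, Fin.isValue]
    linear_combination f * k1 - d * k2
  · refine mul_left_cancel₀ hdet ?_
    simp only [Fin.mk_one, Fin.isValue]
    linear_combination c * k2 - e * k1

theorem tendsto_flip_path (a : ℝ) (u : ℤ) (P : Pt) (v w : ℝ) :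
    ∃ γ : ℝ → Pt, Tendsto γ (𝓝[>] 0) (𝓝 P) ∧
      ∀ t, γ t 0 - P 0 = t * v ∧ flipHeight a u (γ t) - flipHeight a u P = t * w := by
  refine ⟨fun t => ![P 0 + t * v,
    P 1 + t * w + u * max (P 0 - a) 0 - u * max (P 0 + t * v - a) 0], ?_, fun t => ?_⟩
  · have hc : Continuous fun t : ℝ => (![P 0 + t * v,
        P 1 + t * w + u * max (P 0 - a) 0 - u * max (P 0 + t * v - a) 0] : Pt) := by fun_prop
    have h0 : (![P 0 + 0 * v,
        P 1 + 0 * w + u * max (P 0 - a) 0 - u * max (P 0 + 0 * v - a) 0] : Pt) = P := by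
      ext i
      fin_cases i <;> simp
    have := hc.tendsto 0
    rw [h0] at this
    exact this.mono_left nhdsWithin_le_nhds
  · constructor
    · simp
    · simp only [flipHeight, Matrix.cons_val_zero, Matrix.cons_val_one, Matrix.cons_val_fin_one]
      ring

/-- Near its vertex, a packed triangle determines the tangent cone of the polygon. -/
theorem IsSTPackedTriangleIn.exists_cone {a h lam : ℝ} {Δ B : Set Pt} {P : Pt}
    (H : IsSTPackedTriangleIn Δ ![![a, h]] ![1] P lam B) :
    ∃ u : ℤ, (u = 0 ∨ u = 1) ∧ ∃ p q r s : ℤ, p * s - q * r = 1 ∧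
      (∀ x : Pt, x ∈ B ↔
        0 ≤ p * (x 0 - P 0) + q * (flipHeight a u x - flipHeight a u P) ∧
        0 ≤ r * (x 0 - P 0) + s * (flipHeight a u x - flipHeight a u P) ∧
        (p * (x 0 - P 0) + q * (flipHeight a u x - flipHeight a u P)) +
          (r * (x 0 - P 0) + s * (flipHeight a u x - flipHeight a u P)) < lam) ∧
      ∀ C : ℝ → ℝ → Prop, (∀ t v w : ℝ, 0 < t → (C (t * v) (t * w) ↔ C v w)) →
        (∀ᶠ x in 𝓝 P, x ∈ Δ ↔ C (x 0 - P 0) (flipHeight a u x - flipHeight a u P)) →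
        ∀ v w : ℝ, C v w ↔ 0 ≤ p * v + q * w ∧ 0 ≤ r * v + s * w := by
  obtain ⟨u, hu, p, q, r, s, hdet, hB, hev⟩ := H.exists_coords
  refine ⟨u, hu, p, q, r, s, hdet, hB, fun C hC hΔ v w => ?_⟩
  obtain ⟨γ, hγ, hγ'⟩ := tendsto_flip_path a u P v w
  have hsmall : ∀ᶠ t : ℝ in 𝓝[>] 0, t * ((p * v + q * w) + (r * v + s * w)) < lam := by
    have : Tendsto (fun t : ℝ => t * ((p * v + q * w) + (r * v + s * w))) (𝓝[>] 0) (𝓝 0) := by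
      have h := (by fun_prop : Continuous
        fun t : ℝ => t * ((p * v + q * w) + (r * v + s * w))).tendsto 0
      rw [zero_mul] at h
      exact h.mono_left nhdsWithin_le_nhds
    exact this.eventually_lt_const H.1
  obtain ⟨t, h1, h2, h3, ht⟩ := ((hγ.eventually hev).and ((hγ.eventually hΔ).and
    (hsmall.and self_mem_nhdsWithin))).exists
  have ht : 0 < t := ht
  rw [← hC t v w ht]
  rw [hB, h2, (hγ' t).1, (hγ' t).2] at h1
  rw [← h1, ← mul_nonneg_iff_of_pos_left (b := p * v + q * w) ht,
    ← mul_nonneg_iff_of_pos_left (b := r * v + s * w) ht]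
  constructor
  · rintro ⟨k1, k2, -⟩
    exact ⟨by linarith, by linarith⟩
  · rintro ⟨k1, k2⟩
    exact ⟨by linarith, by linarith, by linarith⟩

/-- Two oriented integral bases spanning the same cone agree. -/
theorem cone_rigidity {p q r s f₁ f₂ g₁ g₂ : ℤ} (hdet : p * s - q * r = 1)
    (hfg : f₁ * g₂ - f₂ * g₁ = 1)
    (H : ∀ v w : ℝ, (0 ≤ f₁ * v + f₂ * w ∧ 0 ≤ g₁ * v + g₂ * w) ↔
      (0 ≤ p * v + q * w ∧ 0 ≤ r * v + s * w)) :
    p = f₁ ∧ q = f₂ ∧ r = g₁ ∧ s = g₂ := by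
  have HZ : ∀ v w : ℤ, (0 ≤ f₁ * v + f₂ * w ∧ 0 ≤ g₁ * v + g₂ * w) ↔
      (0 ≤ p * v + q * w ∧ 0 ≤ r * v + s * w) := fun v w => by exact_mod_cast H v w
  obtain ⟨h1, h2⟩ := (HZ g₂ (-g₁)).1 ⟨by linarith, by linarith⟩
  obtain ⟨h3, h4⟩ := (HZ (-f₂) f₁).1 ⟨by linarith, by linarith⟩
  obtain ⟨h5, h6⟩ := (HZ s (-r)).2 ⟨by linarith, by linarith⟩
  obtain ⟨h7, h8⟩ := (HZ (-q) p).2 ⟨by linarith, by linarith⟩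
  have e1 : p * -f₂ + q * f₁ = 0 := by linarith
  have e2 : r * g₂ + s * -g₁ = 0 := by linarith
  have e3 : (p * g₂ + q * -g₁) * (r * -f₂ + s * f₁) = 1 := by
    linear_combination (f₁ * g₂ - f₂ * g₁) * hdet + hfg + (r * g₂ + s * -g₁) * e1
  have e4 : p * g₂ + q * -g₁ = 1 := Int.eq_one_of_mul_eq_one_right h1 e3
  have e5 : r * -f₂ + s * f₁ = 1 := by rwa [e4, one_mul] at e3
  refine ⟨?_, ?_, ?_, ?_⟩
  · linear_combination -p * hfg + f₁ * e4 + g₁ * e1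
  · linear_combination -q * hfg + f₂ * e4 + g₂ * e1
  · linear_combination -r * hfg + f₁ * e2 + g₁ * e5
  · linear_combination -s * hfg + f₂ * e2 + g₂ * e5

/-- A set which is either a packed triangle of size `lam > 0` at `P`, or empty with `lam = 0`. -/
def IsOptionalTriangle (Δ : Set Pt) (a h : ℝ) (P : Pt) (lam : ℝ) (B : Set Pt) : Prop :=
  IsSTPackedTriangleIn Δ ![![a, h]] ![1] P lam B ∨ lam = 0 ∧ B = ∅

theorem IsOptionalTriangle.nonneg {Δ : Set Pt} {a h : ℝ} {P : Pt} {lam : ℝ} {B : Set Pt}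
    (H : IsOptionalTriangle Δ a h P lam B) : 0 ≤ lam := by
  rcases H with H | ⟨rfl, -⟩
  exacts [H.1.le, le_rfl]

theorem IsOptionalTriangle.subset {Δ : Set Pt} {a h : ℝ} {P : Pt} {lam : ℝ} {B : Set Pt}
    (H : IsOptionalTriangle Δ a h P lam B) : B ⊆ Δ := by
  rcases H with H | ⟨-, rfl⟩
  exacts [H.2.1, empty_subset _]

theorem IsOptionalTriangle.marked_notMem {Δ : Set Pt} {a h : ℝ} {P : Pt} {lam : ℝ} {B : Set Pt}
    (H : IsOptionalTriangle Δ a h P lam B) : ![a, h] ∉ B := by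
  rcases H with H | ⟨-, rfl⟩
  exacts [H.2.2.1 0, notMem_empty _]

/-- If, for both cut directions, the polygon is near `P` a unimodular cone in the coordinates
`x 0` and `flipHeight`, then a triangle packed at `P` is cut out by the corresponding
inequalities. -/
theorem IsOptionalTriangle.exists_mem_iff {Δ : Set Pt} {a h : ℝ} {P : Pt} {lam : ℝ} {B : Set Pt}
    (H : IsOptionalTriangle Δ a h P lam B) (f₁ f₂ g₁ g₂ : ℤ → ℤ)
    (hdet : ∀ u, f₁ u * g₂ u - f₂ u * g₁ u = 1)
    (hΔ : ∀ u : ℤ, ∀ᶠ x in 𝓝 P, x ∈ Δ ↔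
      0 ≤ f₁ u * (x 0 - P 0) + f₂ u * (flipHeight a u x - flipHeight a u P) ∧
      0 ≤ g₁ u * (x 0 - P 0) + g₂ u * (flipHeight a u x - flipHeight a u P)) :
    ∃ u : ℤ, (u = 0 ∨ u = 1) ∧ ∀ x : Pt, x ∈ B ↔
      0 ≤ f₁ u * (x 0 - P 0) + f₂ u * (flipHeight a u x - flipHeight a u P) ∧
      0 ≤ g₁ u * (x 0 - P 0) + g₂ u * (flipHeight a u x - flipHeight a u P) ∧
      (f₁ u * (x 0 - P 0) + f₂ u * (flipHeight a u x - flipHeight a u P)) +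
        (g₁ u * (x 0 - P 0) + g₂ u * (flipHeight a u x - flipHeight a u P)) < lam := by
  rcases H with H | ⟨rfl, rfl⟩
  · obtain ⟨u, hu, p, q, r, s, hd, hB, hcone⟩ := H.exists_cone
    have := hcone (fun v w => 0 ≤ f₁ u * v + f₂ u * w ∧ 0 ≤ g₁ u * v + g₂ u * w)
      (fun t v w ht => by
        rw [← mul_nonneg_iff_of_pos_left (b := f₁ u * v + f₂ u * w) ht,
          ← mul_nonneg_iff_of_pos_left (b := g₁ u * v + g₂ u * w) ht]
        ring_nf) (hΔ u)
    obtain ⟨rfl, rfl, rfl, rfl⟩ := cone_rigidity hd (hdet u) this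
    exact ⟨u, hu, hB⟩
  · refine ⟨0, Or.inl rfl, fun x => ⟨fun h => h.elim, fun ⟨h1, h2, h3⟩ => ?_⟩⟩
    linarith

section Vertices

variable {a b h lam : ℝ} {n : ℤ} {B : Set Pt}

theorem IsOptionalTriangle.mem_iff_origin (ha : 0 < a) (hb : 0 < b) (hn : 1 ≤ n)
    (H : IsOptionalTriangle (trapezoid a b n) a h ![0, 0] lam B) :
    ∃ u : ℤ, ∀ x : Pt, x ∈ B ↔
      0 ≤ x 0 - flipHeight a u x ∧ 0 ≤ flipHeight a u x ∧ x 0 < lam := by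
  have hnR : (1 : ℝ) ≤ n := by exact_mod_cast hn
  have h00 : ∀ u, flipHeight a u ![0, 0] = 0 := fun u => by
    rw [flipHeight_of_le] <;> simp [ha.le]
  obtain ⟨u, -, hB⟩ := H.exists_mem_iff (fun _ => 1) (fun _ => -1) (fun _ => 0) (fun _ => 1)
    (fun _ => by norm_num) (fun u => by
      have c0 : ContinuousAt (fun x : Pt => x 0) ![0, 0] := (continuous_apply 0).continuousAt
      have c1 : ContinuousAt (fun x : Pt => x 1) ![0, 0] := (continuous_apply 1).continuousAt
      have c2 : ContinuousAt (fun x : Pt => x 0 + (n - 1) * x 1) ![0, 0] := by fun_prop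
      filter_upwards [c0.eventually_lt_const (u := a) (by simpa using ha),
        c1.eventually_lt_const (u := a) (by simpa using ha),
        c2.eventually_lt_const (u := n * a + b) (by simp; positivity)] with x h0 h1 h2
      rw [h00, flipHeight_of_le h0.le]
      simp only [trapezoid, mem_ofPred_eq, Matrix.cons_val_zero, Int.cast_one, Int.cast_neg,
        Int.cast_zero]
      constructor
      · rintro ⟨k1, k2, k3, k4⟩
        exact ⟨by linarith, by linarith⟩
      · rintro ⟨k1, k2⟩
        exact ⟨by linarith, by linarith, by linarith, by linarith⟩)
  refine ⟨u, fun x => ?_⟩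
  rw [hB, h00]
  simp [← sub_eq_add_neg]

theorem IsOptionalTriangle.mem_iff_topLeft (ha : 0 < a) (hb : 0 < b)
    (H : IsOptionalTriangle (trapezoid a b n) a h ![a, a] lam B) :
    ∀ x : Pt, x ∈ B ↔ 0 ≤ a - x 1 ∧ 0 ≤ x 0 - x 1 ∧ (a - x 1) + (x 0 - x 1) < lam := by
  rcases H with H | ⟨rfl, rfl⟩
  · obtain ⟨u, hu, p, q, r, s, hd, hB, hcone⟩ := H.exists_cone
    have haa : flipHeight a u ![a, a] = a := by
      rw [flipHeight_of_le] <;> simp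
    have hΔ : ∀ᶠ x in 𝓝 (![a, a] : Pt), x ∈ trapezoid a b n ↔ x 1 ≤ a ∧ x 1 ≤ x 0 := by
      have c1 : ContinuousAt (fun x : Pt => x 1) ![a, a] := (continuous_apply 1).continuousAt
      have c2 : ContinuousAt (fun x : Pt => x 0 + (n - 1) * x 1) ![a, a] := by fun_prop
      filter_upwards [c1.eventually_const_lt (u := 0) (by simpa using ha),
        c2.eventually_lt_const (u := n * a + b) (by simp; linarith)] with x h1 h2
      simp only [trapezoid, mem_ofPred_eq]
      exact ⟨fun k => ⟨k.2.1, k.2.2.1⟩, fun k => ⟨h1.le, k.1, k.2, h2.le⟩⟩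
    rcases hu with rfl | rfl
    · have := hcone (fun v w => 0 ≤ (0 : ℤ) * v + (-1 : ℤ) * w ∧ 0 ≤ (1 : ℤ) * v + (-1 : ℤ) * w)
        (fun t v w ht => by
          rw [← mul_nonneg_iff_of_pos_left (b := (0 : ℤ) * v + (-1 : ℤ) * w) ht,
            ← mul_nonneg_iff_of_pos_left (b := (1 : ℤ) * v + (-1 : ℤ) * w) ht]
          ring_nf) (by
          filter_upwards [hΔ] with x hx
          rw [hx, haa]
          simp [flipHeight])
      obtain ⟨rfl, rfl, rfl, rfl⟩ := cone_rigidity hd (by norm_num) this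
      intro x
      rw [hB, haa]
      simp only [flipHeight, Matrix.cons_val_zero]
      push_cast
      ring_nf
    · have := hcone (fun v w => w ≤ v)
        (fun t v w ht => mul_le_mul_iff_right₀ ht) (by
          filter_upwards [hΔ] with x hx
          rw [hx, haa]
          simp only [Matrix.cons_val_zero]
          rcases le_total (x 0) a with h0 | h0
          · rw [flipHeight_of_le h0]
            exact ⟨fun k => by linarith [k.2], fun k => ⟨by linarith, by linarith⟩⟩
          · rw [flipHeight_of_ge h0]
            push_cast
            exact ⟨fun k => by linarith [k.1], fun k => ⟨by linarith, by linarith⟩⟩)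
      have k1 := (this 1 1).1 le_rfl
      have k2 := (this (-1) (-1)).1 le_rfl
      have e1 : (p : ℝ) + q = 0 := by linarith [k1.1, k2.1]
      have e2 : (r : ℝ) + s = 0 := by linarith [k1.2, k2.2]
      have hdR : (p : ℝ) * s - q * r = 1 := by exact_mod_cast hd
      have : (0 : ℝ) = 1 := by linear_combination hdR + r * e1 - p * e2
      norm_num at this
  · refine fun x => ⟨fun h => h.elim, fun ⟨h1, h2, h3⟩ => ?_⟩
    linarith

theorem IsOptionalTriangle.mem_iff_topRight (ha : 0 < a) (hb : 0 < b)
    (H : IsOptionalTriangle (trapezoid a b n) a h ![a + b, a] lam B) :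
    ∃ u : ℤ, (u = 0 ∨ u = 1) ∧ ∀ x : Pt, x ∈ B ↔
      0 ≤ ((n - 1) * u - 1) * (x 0 - (a + b)) - (n - 1) * (flipHeight a u x - (a + u * b)) ∧
      0 ≤ u * (x 0 - (a + b)) - (flipHeight a u x - (a + u * b)) ∧
      (n * u - 1) * (x 0 - (a + b)) - n * (flipHeight a u x - (a + u * b)) < lam := by
  have haa : ∀ u, flipHeight a u ![a + b, a] = a + u * b := fun u => by
    rw [flipHeight_of_ge] <;> simp [hb.le]
  obtain ⟨u, hu, hB⟩ := H.exists_mem_iff (fun u => (n - 1) * u - 1) (fun _ => -(n - 1))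
    (fun u => u) (fun _ => -1) (fun _ => by ring) (fun u => by
      have c0 : ContinuousAt (fun x : Pt => x 0) ![a + b, a] := (continuous_apply 0).continuousAt
      have c1 : ContinuousAt (fun x : Pt => x 1) ![a + b, a] := (continuous_apply 1).continuousAt
      have c2 : ContinuousAt (fun x : Pt => x 0 - x 1) ![a + b, a] := by fun_prop
      filter_upwards [c0.eventually_const_lt (u := a) (by simpa using hb),
        c1.eventually_const_lt (u := 0) (by simpa using ha),
        c2.eventually_const_lt (u := 0) (by simpa using hb)] with x h0 h1 h2
      rw [haa, flipHeight_of_ge h0.le]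
      simp only [trapezoid, mem_ofPred_eq, Matrix.cons_val_zero]
      push_cast
      constructor
      · rintro ⟨k1, k2, k3, k4⟩
        exact ⟨by linarith, by linarith⟩
      · rintro ⟨k1, k2⟩
        exact ⟨by linarith, by linarith, by linarith, by linarith⟩)
  refine ⟨u, hu, fun x => ?_⟩
  rw [hB, haa]
  simp only [Matrix.cons_val_zero]
  push_cast
  ring_nf

theorem IsOptionalTriangle.mem_iff_bottomRight (ha : 0 < a) (hb : 0 < b) (hn : 1 ≤ n)
    (H : IsOptionalTriangle (trapezoid a b n) a h ![n * a + b, 0] lam B) :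
    ∃ u : ℤ, (u = 0 ∨ u = 1) ∧ ∀ x : Pt, x ∈ B ↔
      0 ≤ (flipHeight a u x - u * ((n - 1) * a + b)) - u * (x 0 - (n * a + b)) ∧
      0 ≤ ((n - 1) * u - 1) * (x 0 - (n * a + b)) -
        (n - 1) * (flipHeight a u x - u * ((n - 1) * a + b)) ∧
      ((n - 2) * u - 1) * (x 0 - (n * a + b)) -
        (n - 2) * (flipHeight a u x - u * ((n - 1) * a + b)) < lam := by
  have hnR : (1 : ℝ) ≤ n := by exact_mod_cast hn
  have hna : 0 ≤ (n - 1) * a := mul_nonneg (sub_nonneg.2 hnR) ha.le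
  have haa : ∀ u, flipHeight a u ![n * a + b, 0] = u * ((n - 1) * a + b) := fun u => by
    rw [flipHeight_of_ge]
    · simp
      left
      ring
    · simp
      linarith
  obtain ⟨u, hu, hB⟩ := H.exists_mem_iff (fun u => -u) (fun _ => 1)
    (fun u => (n - 1) * u - 1) (fun _ => -(n - 1)) (fun _ => by ring) (fun u => by
      have c0 : ContinuousAt (fun x : Pt => x 0) ![n * a + b, 0] := (continuous_apply
        0).continuousAt
      have c1 : ContinuousAt (fun x : Pt => x 1) ![n * a + b, 0] := (continuous_apply
        1).continuousAt
      have c2 : ContinuousAt (fun x : Pt => x 0 - x 1) ![n * a + b, 0] := by fun_prop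
      filter_upwards [c0.eventually_const_lt (u := a) (by simp; linarith),
        c1.eventually_lt_const (u := a) (by simpa using ha),
        c2.eventually_const_lt (u := 0) (by simp; linarith)] with x h0 h1 h2
      rw [haa, flipHeight_of_ge h0.le]
      simp only [trapezoid, mem_ofPred_eq, Matrix.cons_val_zero]
      push_cast
      constructor
      · rintro ⟨k1, k2, k3, k4⟩
        exact ⟨by linarith, by linarith⟩
      · rintro ⟨k1, k2⟩
        exact ⟨by linarith, by linarith, by linarith, by linarith⟩)
  refine ⟨u, hu, fun x => ?_⟩
  rw [hB, haa]
  simp only [Matrix.cons_val_zero]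
  push_cast
  ring_nf

end Vertices

section Constraints

variable {a b h x y z w : ℝ} {n : ℤ} {B₁ B₂ B₃ B₄ : Set Pt}

theorem size_origin_le (ha : 0 < a) (hb : 0 < b) (hn : 1 ≤ n) (hh0 : 0 < h) (hha : h < a)
    (H₁ : IsOptionalTriangle (trapezoid a b n) a h ![0, 0] x B₁) : x ≤ a := by
  obtain ⟨u, hB⟩ := H₁.mem_iff_origin ha hb hn
  by_contra! hx
  refine H₁.marked_notMem ((hB _).2 ?_)
  rw [flipHeight_of_le (by simp)]
  exact ⟨by simp [hha.le], by simp [hh0.le], by simpa using hx⟩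

/-- Triangles at the two ends of the left edge. -/
theorem size_origin_add_size_topLeft_le (ha : 0 < a) (hb : 0 < b) (hn : 1 ≤ n)
    (hh0 : 0 < h) (hha : h < a)
    (H₁ : IsOptionalTriangle (trapezoid a b n) a h ![0, 0] x B₁)
    (H₄ : IsOptionalTriangle (trapezoid a b n) a h ![a, a] w B₄) (hd : Disjoint B₁ B₄) :
    x + w ≤ a := by
  obtain ⟨u, hB₁⟩ := H₁.mem_iff_origin ha hb hn
  have hB₄ := H₄.mem_iff_topLeft ha hb
  have hx := size_origin_le ha hb hn hh0 hha H₁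
  have hw : w ≤ a := by
    by_contra! hw
    obtain ⟨t, ht1, ht2⟩ := exists_between (show a - w < 0 by linarith)
    have : ![t, t] ∈ B₄ := by
      rw [hB₄]
      simp
      constructor <;> linarith
    have := (H₄.subset this).1
    simp at this
    linarith
  have := H₁.nonneg
  have := H₄.nonneg
  by_contra! hxw
  obtain ⟨t, ht1, ht2⟩ := exists_between (show a - w < x by linarith)
  refine Set.disjoint_left.1 hd (?_ : ![t, t] ∈ B₁) ?_
  · rw [hB₁, flipHeight_of_le (by simp; linarith)]
    simp
    constructor <;> linarith
  · rw [hB₄]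
    simp
    constructor <;> linarith

/-- Triangles at the two ends of the top edge. -/
theorem size_topRight_add_size_topLeft_le (ha : 0 < a) (hb : 0 < b)
    (H₂ : IsOptionalTriangle (trapezoid a b n) a h ![a + b, a] y B₂)
    (H₄ : IsOptionalTriangle (trapezoid a b n) a h ![a, a] w B₄) (hd : Disjoint B₂ B₄) :
    w = 0 ∨ y + w ≤ b := by
  obtain ⟨u, -, hB₂⟩ := H₂.mem_iff_topRight ha hb
  have hB₄ := H₄.mem_iff_topLeft ha hb
  have hw : w ≤ b := by
    by_contra! hw
    obtain ⟨t, ht1, ht2⟩ := exists_between hw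
    have : ![a + t, a] ∈ B₄ := by
      rw [hB₄]
      simp
      constructor <;> linarith
    have := (H₄.subset this).2.2.2
    simp at this
    linarith
  have hy0 := H₂.nonneg
  have hw0 := H₄.nonneg
  by_contra! hyw
  obtain ⟨hw1, hyw⟩ := hyw
  have hw0 : 0 < w := lt_of_le_of_ne hw0 (Ne.symm hw1)
  obtain ⟨t, ht1, ht2⟩ := exists_between (show max 0 (b - y) < w by
    rw [max_lt_iff]; constructor <;> linarith)
  rw [max_lt_iff] at ht1
  refine Set.disjoint_left.1 hd (?_ : ![a + t, a] ∈ B₂) ?_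
  · rw [hB₂, flipHeight_of_ge (by simp; linarith)]
    simp only [Matrix.cons_val_zero, Matrix.cons_val_one, Matrix.cons_val_fin_one]
    refine ⟨?_, ?_, ?_⟩ <;> linarith
  · rw [hB₄]
    simp
    constructor <;> linarith

/-- Triangles at the two ends of the right edge. -/
theorem size_topRight_add_size_bottomRight_le (ha : 0 < a) (hb : 0 < b) (hn : 1 ≤ n)
    (H₂ : IsOptionalTriangle (trapezoid a b n) a h ![a + b, a] y B₂)
    (H₃ : IsOptionalTriangle (trapezoid a b n) a h ![n * a + b, 0] z B₃) (hd : Disjoint B₂ B₃) :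
    y + z ≤ a := by
  obtain ⟨u, -, hB₂⟩ := H₂.mem_iff_topRight ha hb
  obtain ⟨v, -, hB₃⟩ := H₃.mem_iff_bottomRight ha hb hn
  have hnR : (1 : ℝ) ≤ n := by exact_mod_cast hn
  have key₂ : ∀ t : ℝ, 0 ≤ t → t < y → (n - 1) * (-t) < b →
      ![n * a + b - (n - 1) * (a - t), a - t] ∈ B₂ := by
    intro t ht0 ht hnt
    rw [hB₂, flipHeight_of_ge (by simp; linarith)]
    simp only [Matrix.cons_val_zero, Matrix.cons_val_one, Matrix.cons_val_fin_one]
    refine ⟨?_, ?_, ?_⟩ <;> linarith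
  have key₃ : ∀ t : ℝ, 0 ≤ t → t < z → (n - 1) * (t - a) < b →
      ![n * a + b - (n - 1) * t, t] ∈ B₃ := by
    intro t ht0 ht hnt
    rw [hB₃, flipHeight_of_ge (by simp; linarith)]
    simp only [Matrix.cons_val_zero, Matrix.cons_val_one, Matrix.cons_val_fin_one]
    refine ⟨?_, ?_, ?_⟩ <;> linarith
  have hy : y ≤ a := by
    by_contra! hy
    obtain ⟨t, ht1, ht2⟩ := exists_between hy
    have := (H₂.subset (key₂ t (by linarith) ht2 (by nlinarith))).1
    simp at this
    linarith
  have hz : z ≤ a := by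
    by_contra! hz
    have hnb : 0 < b / n := by positivity
    obtain ⟨t, ht1, ht2⟩ := exists_between (show a < min z (a + b / n) by
      rw [lt_min_iff]; constructor <;> linarith)
    rw [lt_min_iff, ← sub_lt_iff_lt_add', lt_div_iff₀ (by linarith)] at ht2
    have := (H₃.subset (key₃ t (by linarith) ht2.1 (by nlinarith))).2.1
    simp at this
    linarith
  have hy0 := H₂.nonneg
  have hz0 := H₃.nonneg
  by_contra! hyz
  obtain ⟨t, ht1, ht2⟩ := exists_between (show a - y < z by linarith)
  have m₂ := key₂ (a - t) (by linarith) (by linarith)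
    (by nlinarith [mul_nonneg (sub_nonneg.2 hnR) (show 0 ≤ a - t by linarith)])
  rw [sub_sub_cancel] at m₂
  exact Set.disjoint_left.1 hd m₂ (key₃ t (by linarith) ht2
    (by nlinarith [mul_nonneg (sub_nonneg.2 hnR) (show 0 ≤ a - t by linarith)]))

/-- Triangles at the two ends of the bottom edge, for `n = 1`. -/
theorem size_origin_add_size_bottomRight_le (ha : 0 < a) (hb : 0 < b)
    (hh0 : 0 < h) (hha : h < a)
    (H₁ : IsOptionalTriangle (trapezoid a b 1) a h ![0, 0] x B₁)
    (H₃ : IsOptionalTriangle (trapezoid a b 1) a h ![((1 : ℤ) : ℝ) * a + b, 0] z B₃)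
    (hza : z ≤ a) (hd : Disjoint B₁ B₃) :
    x + z ≤ a + b := by
  have hx := size_origin_le ha hb le_rfl hh0 hha H₁
  obtain ⟨u, hB₁⟩ := H₁.mem_iff_origin ha hb le_rfl
  obtain ⟨v, hv, hB₃⟩ := H₃.mem_iff_bottomRight ha hb le_rfl
  by_contra! hxz
  obtain ⟨t, ht1, ht2⟩ := exists_between (show a + b - z < x by linarith)
  rcases hv with rfl | rfl
  · refine Set.disjoint_left.1 hd (?_ : ![t, 0] ∈ B₁) ?_
    · rw [hB₁, flipHeight_of_le (by simp; linarith)]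
      simp
      constructor <;> linarith
    · rw [hB₃, flipHeight_of_le (by simp; linarith)]
      simp
      constructor <;> linarith
  · have : ![t, t - a] ∈ B₃ := by
      rw [hB₃, flipHeight_of_le (by simp; linarith)]
      simp only [Matrix.cons_val_zero, Matrix.cons_val_one, Matrix.cons_val_fin_one]
      push_cast
      refine ⟨?_, ?_, ?_⟩ <;> linarith
    have := (H₃.subset this).1
    simp at this
    linarith

/-- Triangles at the two ends of the top edge of the polygon with flipped cut, for `n = 1`. -/
theorem size_origin_add_size_topRight_le (ha : 0 < a) (hb : 0 < b)
    (hh0 : 0 < h) (hha : h < a)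
    (H₁ : IsOptionalTriangle (trapezoid a b 1) a h ![0, 0] x B₁)
    (H₂ : IsOptionalTriangle (trapezoid a b 1) a h ![a + b, a] y B₂)
    (hya : y ≤ a) (hd : Disjoint B₁ B₂) :
    y ≤ b ∨ x + y ≤ a + b := by
  have hx := size_origin_le ha hb le_rfl hh0 hha H₁
  obtain ⟨u, hB₁⟩ := H₁.mem_iff_origin ha hb le_rfl
  obtain ⟨v, hv, hB₂⟩ := H₂.mem_iff_topRight ha hb
  by_contra! hxy
  rcases hv with rfl | rfl
  · obtain ⟨t, ht1, ht2⟩ := exists_between hxy.1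
    have : ![a + b - t, a] ∈ B₂ := by
      rw [hB₂, flipHeight_of_le (by simp; linarith)]
      simp
      constructor <;> linarith
    have := (H₂.subset this).2.2.1
    simp at this
    linarith
  · obtain ⟨t, ht1, ht2⟩ := exists_between (show a + b - y < x by linarith)
    refine Set.disjoint_left.1 hd (?_ : ![t, t] ∈ B₁) ?_
    · rw [hB₁, flipHeight_of_le (by simp; linarith)]
      simp
      constructor <;> linarith
    · rw [hB₂, flipHeight_of_le (by simp; linarith)]
      simp only [Matrix.cons_val_zero, Matrix.cons_val_one, Matrix.cons_val_fin_one]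
      push_cast
      refine ⟨?_, ?_, ?_⟩ <;> linarith

end Constraints

/-- The sizes of the triangles of a packing, extended by zero to the vertices that are not used. -/
theorem exists_optionalTriangles {a b h : ℝ} {n : ℤ} {P : Set Pt} (ha : 0 < a) (hb : 0 < b)
    (hn : 1 ≤ n) (hP : IsSTPackingIn (trapezoid a b n) ![![a, h]] ![1] P) :
    ∃ x y z w : ℝ, ∃ B₁ B₂ B₃ B₄ : Set Pt,
      IsOptionalTriangle (trapezoid a b n) a h ![0, 0] x B₁ ∧
      IsOptionalTriangle (trapezoid a b n) a h ![a + b, a] y B₂ ∧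
      IsOptionalTriangle (trapezoid a b n) a h ![n * a + b, 0] z B₃ ∧
      IsOptionalTriangle (trapezoid a b n) a h ![a, a] w B₄ ∧
      Disjoint B₁ B₂ ∧ Disjoint B₁ B₃ ∧ Disjoint B₁ B₄ ∧ Disjoint B₂ B₃ ∧ Disjoint B₂ B₄ ∧
      area P = (x ^ 2 + y ^ 2 + z ^ 2 + w ^ 2) / 2 := by
  obtain ⟨N, pt, lam, tri, rfl, hinj, hext, htri, hdisj⟩ := hP
  let V : Fin 4 → Pt := ![![0, 0], ![a + b, a], ![n * a + b, 0], ![a, a]]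
  have hk : ∀ i, ∃ k, pt i = V k := fun i => by
    have := hext i
    rw [← convexHull_eq_trapezoid ha hb hn] at this
    rcases extremePoints_convexHull_subset this with h | h | h | h
    exacts [⟨0, h⟩, ⟨3, h⟩, ⟨1, h⟩, ⟨2, h⟩]
  choose k hk using hk
  have hkinj : Function.Injective k := fun i j hij => hinj (by rw [hk, hk, hij])
  let X : Fin 4 → ℝ := Function.extend k lam 0
  let Y : Fin 4 → Set Pt := Function.extend k tri fun _ => ∅
  have hX : ∀ j, IsOptionalTriangle (trapezoid a b n) a h (V j) (X j) (Y j) := by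
    intro j
    by_cases hj : ∃ i, k i = j
    · obtain ⟨i, rfl⟩ := hj
      left
      simp only [X, Y, hkinj.extend_apply, ← hk]
      exact htri i
    · right
      exact ⟨Function.extend_apply' _ _ _ hj, Function.extend_apply' _ _ _ hj⟩
  have hY : ∀ i j, i ≠ j → Disjoint (Y i) (Y j) := by
    intro i j hij
    by_cases hi : ∃ i', k i' = i
    · by_cases hj : ∃ j', k j' = j
      · obtain ⟨i, rfl⟩ := hi
        obtain ⟨j, rfl⟩ := hj
        simp only [Y, hkinj.extend_apply]
        exact hdisj (fun h => hij (by rw [h]))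
      · simp only [Y, Function.extend_apply' _ _ _ hj, Set.disjoint_empty]
    · simp only [Y, Function.extend_apply' _ _ _ hi, Set.empty_disjoint]
  have hsum : ∑ i, lam i ^ 2 / 2 = ∑ j, X j ^ 2 / 2 := by
    have h1 : ∀ i, lam i ^ 2 / 2 = X (k i) ^ 2 / 2 := fun i => by
      simp only [X, hkinj.extend_apply]
    rw [Finset.sum_congr rfl fun i _ => h1 i,
      ← Finset.sum_image (f := fun j => X j ^ 2 / 2) hkinj.injOn]
    refine Finset.sum_subset (Finset.subset_univ _) fun j _ hj => ?_
    have hj' : ¬∃ i, k i = j := by simpa using hj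
    simp [X, Function.extend_apply' _ _ _ hj']
  refine ⟨X 0, X 1, X 2, X 3, Y 0, Y 1, Y 2, Y 3, hX 0, hX 1, hX 2, hX 3,
    hY 0 1 (by decide), hY 0 2 (by decide), hY 0 3 (by decide), hY 1 2 (by decide),
    hY 1 3 (by decide), ?_⟩
  rw [area_iUnion_packed htri hdisj, hsum, Fin.sum_univ_four]
  ring

theorem area_packing_le {a b h : ℝ} {n : ℤ} {P : Set Pt} (ha : 0 < a) (hb : 0 < b)
    (hn : 1 ≤ n) (hh0 : 0 < h) (hha : h < a)
    (hP : IsSTPackingIn (trapezoid a b n) ![![a, h]] ![1] P) : area P ≤ a ^ 2 := by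
  obtain ⟨x, y, z, w, B₁, B₂, B₃, B₄, H₁, H₂, H₃, H₄, d₁₂, d₁₃, d₁₄, d₂₃, d₂₄, hA⟩ :=
    exists_optionalTriangles ha hb hn hP
  have h1 := sq_add_sq_le H₁.nonneg H₄.nonneg
    (size_origin_add_size_topLeft_le ha hb hn hh0 hha H₁ H₄ d₁₄)
  have h2 := sq_add_sq_le H₂.nonneg H₃.nonneg
    (size_topRight_add_size_bottomRight_le ha hb hn H₂ H₃ d₂₃)
  linarith

theorem area_packing_le_of_lt {a b h : ℝ} {P : Set Pt} (hb : 0 < b) (hba : b < a)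
    (hh0 : 0 < h) (hha : h < a)
    (hP : IsSTPackingIn (trapezoid a b 1) ![![a, h]] ![1] P) :
    (a < 2 * b → area P ≤ (a ^ 2 + b ^ 2 + (a - b) ^ 2) / 2) ∧
    (2 * b ≤ a → area P ≤ (a ^ 2 + 2 * b ^ 2) / 2) := by
  have ha : 0 < a := hb.trans hba
  obtain ⟨x, y, z, w, B₁, B₂, B₃, B₄, H₁, H₂, H₃, H₄, d₁₂, d₁₃, d₁₄, d₂₃, d₂₄, hA⟩ :=
    exists_optionalTriangles ha hb le_rfl hP
  have hxw := size_origin_add_size_topLeft_le ha hb le_rfl hh0 hha H₁ H₄ d₁₄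
  have hyz := size_topRight_add_size_bottomRight_le ha hb le_rfl H₂ H₃ d₂₃
  have hx := H₁.nonneg
  have hy := H₂.nonneg
  have hz := H₃.nonneg
  have hw := H₄.nonneg
  have hxz := size_origin_add_size_bottomRight_le ha hb hh0 hha H₁ H₃ (by linarith) d₁₃
  have hxy := size_origin_add_size_topRight_le ha hb hh0 hha H₁ H₂ (by linarith) d₁₂
  have hyw := size_topRight_add_size_topLeft_le ha hb H₂ H₄ d₂₄
  rw [hA]
  rcases le_or_gt y b with hyb | hyb
  · have hyw : y + w ≤ b := by
      rcases hyw with rfl | hyw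
      · linarith
      · exact hyw
    exact ⟨fun hab => by linarith [sum_sq_le_of_lt_two_mul hba hx hy hz hw hxw hyz hxz hyw hab],
      fun hab => by linarith [sum_sq_le_of_two_mul_le hb hx hy hz hw hxw hyz hxz hyw hab]⟩
  · have hxy := hxy.resolve_left hyb.not_ge
    have hw0 : w = 0 := hyw.resolve_right (by linarith)
    subst hw0
    exact ⟨fun hab => by linarith [sum_sq_le_of_ge_of_lt_two_mul hx hz hyb.le hyz hxy],
      fun hab => by linarith [sum_sq_le_of_ge_of_two_mul_le hb hx hz hyb.le hyz hxz hxy]⟩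

/-- The triangle at `P` of size `lam` cut out by two linear functionals. -/
def cornerTriangle (P : Pt) (f₁ f₂ g₁ g₂ : ℤ) (lam : ℝ) : Set Pt :=
  {x | 0 ≤ f₁ * (x 0 - P 0) + f₂ * (x 1 - P 1) ∧ 0 ≤ g₁ * (x 0 - P 0) + g₂ * (x 1 - P 1) ∧
    (f₁ * (x 0 - P 0) + f₂ * (x 1 - P 1)) + (g₁ * (x 0 - P 0) + g₂ * (x 1 - P 1)) < lam}

theorem isSTPackedTriangleIn_cornerTriangle {a h lam : ℝ} {Δ : Set Pt} {P : Pt}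
    {f₁ f₂ g₁ g₂ : ℤ} (hdet : f₁ * g₂ - f₂ * g₁ = 1) (hlam : 0 < lam)
    (hΔ : ∀ x : Pt,
      (f₁ * (x 0 - P 0) + f₂ * (x 1 - P 1)) + (g₁ * (x 0 - P 0) + g₂ * (x 1 - P 1)) < lam →
      (x ∈ Δ ↔ 0 ≤ f₁ * (x 0 - P 0) + f₂ * (x 1 - P 1) ∧
        0 ≤ g₁ * (x 0 - P 0) + g₂ * (x 1 - P 1)))
    (hm : ![a, h] ∉ cornerTriangle P f₁ f₂ g₁ g₂ lam) :
    IsSTPackedTriangleIn Δ ![![a, h]] ![1] P lam (cornerTriangle P f₁ f₂ g₁ g₂ lam) := by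
  have hid : stMap ![![a, h]] 0 0 0 = id := by
    ext x i
    fin_cases i <;> simp [stMap]
  have hdetR : (f₁ : ℝ) * g₂ - f₂ * g₁ = 1 := by exact_mod_cast hdet
  obtain ⟨M, hM⟩ : ∃ M : Matrix.SpecialLinearGroup (Fin 2) ℤ,
      (M : Matrix (Fin 2) (Fin 2) ℤ) = !![g₂, -f₂; -g₁, f₁] :=
    ⟨⟨_, by rw [Matrix.det_fin_two_of]; linarith⟩, rfl⟩
  have hM₀ : ∀ z : Pt, sl2Apply M z 0 = g₂ * z 0 - f₂ * z 1 := fun z => by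
    rw [sl2Apply_zero]
    simp [hM, sub_eq_add_neg]
  have hM₁ : ∀ z : Pt, sl2Apply M z 1 = f₁ * z 1 - g₁ * z 0 := fun z => by
    rw [sl2Apply_one]
    simp [hM]
    ring
  refine ⟨hlam, fun x hx => (hΔ x hx.2.2).2 ⟨hx.1, hx.2.1⟩, fun j => ?_, 0, 0, 0,
    fun j => Or.inl rfl, ⟨M, ?_⟩,
    {x | (f₁ * (x 0 - P 0) + f₂ * (x 1 - P 1)) + (g₁ * (x 0 - P 0) + g₂ * (x 1 - P 1)) < lam},
    ?_, ?_, ?_⟩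
  · rw [Subsingleton.elim j 0]
    exact hm
  · rw [hid, image_id]
    ext x
    constructor
    · rintro ⟨h1, h2, h3⟩
      refine ⟨![_, _], ⟨h1, h2, h3⟩, ?_⟩
      ext i
      fin_cases i
      · simp [hM₀]
        linear_combination (x 0 - P 0) * hdetR
      · simp [hM₁]
        linear_combination (x 1 - P 1) * hdetR
    · rintro ⟨z, ⟨h1, h2, h3⟩, rfl⟩
      simp only [cornerTriangle, mem_ofPred_eq, Pi.add_apply, hM₀, hM₁, id_eq,
        add_sub_cancel_right]
      have e0 : f₁ * (g₂ * z 0 - f₂ * z 1) + f₂ * (f₁ * z 1 - g₁ * z 0) = z 0 := by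
        linear_combination z 0 * hdetR
      have e1 : g₁ * (g₂ * z 0 - f₂ * z 1) + g₂ * (f₁ * z 1 - g₁ * z 0) = z 1 := by
        linear_combination z 1 * hdetR
      rw [e0, e1]
      exact ⟨h1, h2, h3⟩
  · exact isOpen_lt (by fun_prop) continuous_const
  · simp [hid, hlam]
  · rw [hid, image_id, image_id]
    ext x
    constructor
    · rintro ⟨hx, hU⟩
      exact ⟨(hΔ x hU).2 ⟨hx.1, hx.2.1⟩, hU⟩
    · rintro ⟨hx, hU⟩
      have := (hΔ x hU).1 hx
      exact ⟨⟨this.1, this.2, hU⟩, hU⟩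

section Construction

variable {a b h lam : ℝ} {n : ℤ}

theorem isSTPackedTriangleIn_origin (hb : 0 < b) (hn : 1 ≤ n)
    (hlam : 0 < lam) (hle : lam ≤ a) :
    IsSTPackedTriangleIn (trapezoid a b n) ![![a, h]] ![1] ![0, 0] lam
      (cornerTriangle ![0, 0] 1 (-1) 0 1 lam) := by
  have hnR : (1 : ℝ) ≤ n := by exact_mod_cast hn
  refine isSTPackedTriangleIn_cornerTriangle (by norm_num) hlam (fun x => ?_) fun hx => ?_
  · simp only [trapezoid, mem_ofPred_eq, Matrix.cons_val_zero, Matrix.cons_val_one,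
      Matrix.cons_val_fin_one]
    push_cast
    intro hx
    constructor
    · rintro ⟨h1, h2, h3, h4⟩
      exact ⟨by linarith, by linarith⟩
    · rintro ⟨h1, h2⟩
      have : (n - 1) * x 1 ≤ (n - 1) * a :=
        mul_le_mul_of_nonneg_left (by linarith) (by linarith)
      exact ⟨by linarith, by linarith, by linarith, by linarith⟩
  · have := hx.2.2
    simp at this
    linarith

theorem isSTPackedTriangleIn_bottomRight (hb : 0 < b) (hn : 1 ≤ n)
    (hlam : 0 < lam) (hle : lam ≤ a)
    (hm : ![a, h] ∉ cornerTriangle ![n * a + b, 0] 0 1 (-1) (1 - n) lam) :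
    IsSTPackedTriangleIn (trapezoid a b n) ![![a, h]] ![1] ![n * a + b, 0] lam
      (cornerTriangle ![n * a + b, 0] 0 1 (-1) (1 - n) lam) := by
  have hnR : (1 : ℝ) ≤ n := by exact_mod_cast hn
  refine isSTPackedTriangleIn_cornerTriangle (by norm_num) hlam (fun x => ?_) hm
  simp only [trapezoid, mem_ofPred_eq, Matrix.cons_val_zero, Matrix.cons_val_one,
    Matrix.cons_val_fin_one]
  push_cast
  intro hx
  constructor
  · rintro ⟨h1, h2, h3, h4⟩
    exact ⟨by linarith, by linarith⟩
  · rintro ⟨h1, h2⟩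
    have : (n - 1) * x 1 ≤ (n - 1) * a :=
      mul_le_mul_of_nonneg_left (by linarith) (by linarith)
    exact ⟨by linarith, by linarith, by linarith, by linarith⟩

theorem isSTPackedTriangleIn_topRight (hlam : 0 < lam) (hla : lam ≤ a) (hlb : lam ≤ b) :
    IsSTPackedTriangleIn (trapezoid a b 1) ![![a, h]] ![1] ![a + b, a] lam
      (cornerTriangle ![a + b, a] (-1) 0 0 (-1) lam) := by
  refine isSTPackedTriangleIn_cornerTriangle (by norm_num) hlam (fun x => ?_) fun hx => ?_
  · simp only [trapezoid, mem_ofPred_eq, Matrix.cons_val_zero, Matrix.cons_val_one,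
      Matrix.cons_val_fin_one]
    push_cast
    intro hx
    constructor
    · rintro ⟨h1, h2, h3, h4⟩
      exact ⟨by linarith, by linarith⟩
    · rintro ⟨h1, h2⟩
      exact ⟨by linarith, by linarith, by linarith, by linarith⟩
  · have h1 := hx.2.1
    have h2 := hx.2.2
    simp at h1 h2
    linarith

theorem origin_mem_extremePoints (ha : 0 < a) (hb : 0 < b) (hn : 1 ≤ n) :
    ![0, 0] ∈ (trapezoid a b n).extremePoints ℝ := by
  have hnR : (1 : ℝ) ≤ n := by exact_mod_cast hn
  refine mem_extremePoints_of_functionals (c := 1) (d := -1) (e := 0) (f := 1) ?_ (by norm_num)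
    ?_ ?_
  · simp [trapezoid, ha.le]
    positivity
  · rintro x ⟨h1, h2, h3, h4⟩
    simp
    linarith
  · rintro x ⟨h1, h2, h3, h4⟩
    simpa using h1

theorem bottomRight_mem_extremePoints (ha : 0 < a) (hb : 0 < b) (hn : 1 ≤ n) :
    ![n * a + b, 0] ∈ (trapezoid a b n).extremePoints ℝ := by
  have hnR : (1 : ℝ) ≤ n := by exact_mod_cast hn
  refine mem_extremePoints_of_functionals (c := -1) (d := -(n - 1)) (e := 0) (f := 1) ?_
    (by norm_num) ?_ ?_
  · simp [trapezoid, ha.le]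
    positivity
  · rintro x ⟨h1, h2, h3, h4⟩
    simp
    linarith
  · rintro x ⟨h1, h2, h3, h4⟩
    simpa using h1

theorem topRight_mem_extremePoints (ha : 0 < a) (hb : 0 < b) :
    ![a + b, a] ∈ (trapezoid a b 1).extremePoints ℝ := by
  refine mem_extremePoints_of_functionals (c := -1) (d := 0) (e := 0) (f := -1) ?_
    (by norm_num) ?_ ?_
  · simp [trapezoid, ha.le, hb.le]
  · rintro x ⟨h1, h2, h3, h4⟩
    simp at h4 ⊢
    linarith
  · rintro x ⟨h1, h2, h3, h4⟩
    simpa using h2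

theorem exists_packing_area_sq (ha : 0 < a) (hb : 0 < b) (hn : 1 ≤ n)
    (hab : a ≤ (n - 1) * a + b) :
    ∃ P, IsSTPackingIn (trapezoid a b n) ![![a, h]] ![1] P ∧ area P = a ^ 2 := by
  have hnR : (1 : ℝ) ≤ n := by exact_mod_cast hn
  have hpos : 0 < n * a + b := by positivity
  have hlt : ∀ x ∈ cornerTriangle ![n * a + b, 0] 0 1 (-1) (1 - n) a, a < x 0 := by
    rintro x ⟨h1, h2, h3⟩
    simp only [Matrix.cons_val_zero, Matrix.cons_val_one, Matrix.cons_val_fin_one] at h1 h2 h3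
    push_cast at h1 h2 h3
    rcases hn.eq_or_lt with rfl | hn
    · push_cast at *
      linarith
    · have hnR : (2 : ℝ) ≤ n := by exact_mod_cast hn
      have : (n - 2) * x 1 ≤ (n - 2) * a :=
        mul_le_mul_of_nonneg_left (by nlinarith) (by linarith)
      linarith
  have htri : ∀ i : Fin 2, IsSTPackedTriangleIn (trapezoid a b n) ![![a, h]] ![1]
      ((![![0, 0], ![n * a + b, 0]] : Fin 2 → Pt) i) ((![a, a] : Fin 2 → ℝ) i)
      ((![cornerTriangle ![0, 0] 1 (-1) 0 1 a,
        cornerTriangle ![n * a + b, 0] 0 1 (-1) (1 - n) a] : Fin 2 → Set Pt) i) := by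
    rw [Fin.forall_fin_two]
    exact ⟨isSTPackedTriangleIn_origin hb hn ha le_rfl,
      isSTPackedTriangleIn_bottomRight hb hn ha le_rfl fun hx => (hlt _ hx).ne (by simp)⟩
  have hdisj : Pairwise (Function.onFun Disjoint
      (![cornerTriangle ![0, 0] 1 (-1) 0 1 a,
        cornerTriangle ![n * a + b, 0] 0 1 (-1) (1 - n) a] : Fin 2 → Set Pt)) := by
    have : Disjoint (cornerTriangle ![0, 0] 1 (-1) 0 1 a)
        (cornerTriangle ![n * a + b, 0] 0 1 (-1) (1 - n) a) := by
      refine Set.disjoint_left.2 fun x h1 h2 => ?_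
      have h3 := hlt x h2
      have h4 := h1.2.2
      simp at h4
      linarith
    intro i j hij
    fin_cases i <;> fin_cases j <;> first | exact absurd rfl hij | exact this | exact this.symm
  refine ⟨_, ⟨2, _, _, _, rfl, ?_, ?_, htri, hdisj⟩, ?_⟩
  · intro i j hij
    have := congrFun hij 0
    fin_cases i <;> fin_cases j <;> simp at this ⊢ <;> linarith
  · rw [Fin.forall_fin_two]
    exact ⟨origin_mem_extremePoints ha hb hn, bottomRight_mem_extremePoints ha hb hn⟩
  · rw [area_iUnion_packed htri hdisj, Fin.sum_univ_two]
    simp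

theorem exists_packing_area_three (hb : 0 < b) (hba : b < a) (hlam : 0 < lam)
    (hlb : lam ≤ b) (hlab : lam ≤ a - b) :
    ∃ P, IsSTPackingIn (trapezoid a b 1) ![![a, h]] ![1] P ∧
      area P = (a ^ 2 + b ^ 2 + lam ^ 2) / 2 := by
  have ha : 0 < a := hb.trans hba
  have hla : lam ≤ a := by linarith
  have hlt₃ : ∀ x ∈ cornerTriangle ![(1 : ℤ) * a + b, 0] 0 1 (-1) (1 - 1) b,
      a < x 0 ∧ 0 ≤ x 1 ∧ x 1 < x 0 - a ∧ x 0 ≤ a + b := by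
    rintro x ⟨h1, h2, h3⟩
    simp at h1 h2 h3
    exact ⟨by linarith, by linarith, by linarith, by linarith⟩
  have hlt₂ : ∀ x ∈ cornerTriangle ![a + b, a] (-1) 0 0 (-1) lam,
      x 1 ≤ a ∧ x 0 ≤ a + b ∧ 2 * a + b - lam < x 0 + x 1 := by
    rintro x ⟨h1, h2, h3⟩
    simp at h1 h2 h3
    exact ⟨by linarith, by linarith, by linarith⟩
  have hlt₁ : ∀ x ∈ cornerTriangle ![0, 0] 1 (-1) 0 1 a, x 0 < a := by
    rintro x ⟨h1, h2, h3⟩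
    simp at h3
    linarith
  have htri : ∀ i : Fin 3, IsSTPackedTriangleIn (trapezoid a b 1) ![![a, h]] ![1]
      ((![![0, 0], ![(1 : ℤ) * a + b, 0], ![a + b, a]] : Fin 3 → Pt) i)
      ((![a, b, lam] : Fin 3 → ℝ) i)
      ((![cornerTriangle ![0, 0] 1 (-1) 0 1 a,
        cornerTriangle ![(1 : ℤ) * a + b, 0] 0 1 (-1) (1 - 1) b,
        cornerTriangle ![a + b, a] (-1) 0 0 (-1) lam] : Fin 3 → Set Pt) i) := by
    intro i
    fin_cases i
    · exact isSTPackedTriangleIn_origin hb le_rfl ha le_rfl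
    · exact isSTPackedTriangleIn_bottomRight hb le_rfl hb hba.le fun hx =>
        (hlt₃ _ hx).1.ne (by simp)
    · exact isSTPackedTriangleIn_topRight hlam hla hlb
  have hdisj : Pairwise (Function.onFun Disjoint
      (![cornerTriangle ![0, 0] 1 (-1) 0 1 a,
        cornerTriangle ![(1 : ℤ) * a + b, 0] 0 1 (-1) (1 - 1) b,
        cornerTriangle ![a + b, a] (-1) 0 0 (-1) lam] : Fin 3 → Set Pt)) := by
    have d₁₃ : Disjoint (cornerTriangle ![0, 0] 1 (-1) 0 1 a)
        (cornerTriangle ![(1 : ℤ) * a + b, 0] 0 1 (-1) (1 - 1) b) :=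
      Set.disjoint_left.2 fun x h1 h2 => lt_asymm (hlt₁ x h1) (hlt₃ x h2).1
    have d₁₂ : Disjoint (cornerTriangle ![0, 0] 1 (-1) 0 1 a)
        (cornerTriangle ![a + b, a] (-1) 0 0 (-1) lam) :=
      Set.disjoint_left.2 fun x h1 h2 => by linarith [hlt₁ x h1, hlt₂ x h2]
    have d₃₂ : Disjoint (cornerTriangle ![(1 : ℤ) * a + b, 0] 0 1 (-1) (1 - 1) b)
        (cornerTriangle ![a + b, a] (-1) 0 0 (-1) lam) :=
      Set.disjoint_left.2 fun x h1 h2 => by linarith [hlt₃ x h1, hlt₂ x h2]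
    intro i j hij
    fin_cases i <;> fin_cases j <;> first
      | exact absurd rfl hij | exact d₁₃ | exact d₁₂ | exact d₃₂
      | exact d₁₃.symm | exact d₁₂.symm | exact d₃₂.symm
  refine ⟨_, ⟨3, _, _, _, rfl, ?_, ?_, htri, hdisj⟩, ?_⟩
  · intro i j hij
    have h0 := congrFun hij 0
    have h1 := congrFun hij 1
    fin_cases i <;> fin_cases j <;> simp at h0 h1 ⊢ <;> linarith
  · intro i
    fin_cases i
    exacts [origin_mem_extremePoints ha hb le_rfl, bottomRight_mem_extremePoints ha hb le_rfl,
      topRight_mem_extremePoints ha hb]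
  · rw [area_iUnion_packed htri hdisj, Fin.sum_univ_three]
    simp
    ring

theorem isLUB_stDensitySet (ha : 0 < a) (hb : 0 < b) (hn : 1 ≤ n) {A ρ : ℝ}
    (hρ : ρ = A / (a * (n * a + 2 * b) / 2))
    (hle : ∀ P, IsSTPackingIn (trapezoid a b n) ![![a, h]] ![1] P → area P ≤ A)
    (hex : ∃ P, IsSTPackingIn (trapezoid a b n) ![![a, h]] ![1] P ∧ area P = A) :
    IsLUB (stDensitySet
      (convexHull ℝ {![0, 0], ![a, a], ![a + b, a], ![(n : ℝ) * a + b, 0]})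
      (![![a, h]] : Fin 1 → Pt) (![1] : Fin 1 → ℤ)) ρ := by
  have hnR : (1 : ℝ) ≤ n := by exact_mod_cast hn
  rw [convexHull_eq_trapezoid ha hb hn, hρ, ← area_trapezoid ha hb hn]
  obtain ⟨P, hP, hA⟩ := hex
  refine IsGreatest.isLUB ⟨⟨P, hP, by rw [hA]⟩, ?_⟩
  rintro r ⟨Q, hQ, rfl⟩
  exact div_le_div_of_nonneg_right (hle Q hQ) ENNReal.toReal_nonneg

end Construction

/-- The semitoric packing density of the minimal semitoric polygon of
type (3a) — with vertices `(0,0)`, `(a,a)`, `(a+b,a)`, `(na+b,0)`, marked point `(a,h)`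
with `0 < h < a`, and upward cut — for `a, b > 0` and an integer `n ≥ 1`. In all cases
the density is independent of `h`. -/
theorem stmt16 (a b h : ℝ) (n : ℤ) (ha : 0 < a) (hb : 0 < b) (hn : 1 ≤ n)
    (hh0 : 0 < h) (hha : h < a) :
    (1 < n → IsLUB
      (stDensitySet
        (convexHull ℝ {![0, 0], ![a, a], ![a + b, a], ![(n : ℝ) * a + b, 0]})
        (![![a, h]] : Fin 1 → Pt) (![1] : Fin 1 → ℤ))
      (2 * a / ((n : ℝ) * a + 2 * b))) ∧
    (n = 1 → a ≤ b → IsLUB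
      (stDensitySet
        (convexHull ℝ {![0, 0], ![a, a], ![a + b, a], ![(n : ℝ) * a + b, 0]})
        (![![a, h]] : Fin 1 → Pt) (![1] : Fin 1 → ℤ))
      (2 * a / (a + 2 * b))) ∧
    (n = 1 → b < a → a < 2 * b → IsLUB
      (stDensitySet
        (convexHull ℝ {![0, 0], ![a, a], ![a + b, a], ![(n : ℝ) * a + b, 0]})
        (![![a, h]] : Fin 1 → Pt) (![1] : Fin 1 → ℤ))
      ((a ^ 2 + b ^ 2 + (a - b) ^ 2) / ((a + 2 * b) * a))) ∧
    (n = 1 → 2 * b ≤ a → IsLUB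
      (stDensitySet
        (convexHull ℝ {![0, 0], ![a, a], ![a + b, a], ![(n : ℝ) * a + b, 0]})
        (![![a, h]] : Fin 1 → Pt) (![1] : Fin 1 → ℤ))
      ((a ^ 2 + 2 * b ^ 2) / ((a + 2 * b) * a))) := by
  refine ⟨fun hn1 => ?_, fun hn1 hab => ?_, fun hn1 hba hab => ?_, fun hn1 hab => ?_⟩
  · have hnR : (2 : ℝ) ≤ n := by exact_mod_cast hn1
    refine isLUB_stDensitySet ha hb hn (A := a ^ 2) ?_
      (fun P hP => area_packing_le ha hb hn hh0 hha hP)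
      (exists_packing_area_sq ha hb hn (by nlinarith))
    field_simp
  · subst hn1
    refine isLUB_stDensitySet ha hb hn (A := a ^ 2) ?_
      (fun P hP => area_packing_le ha hb hn hh0 hha hP)
      (exists_packing_area_sq ha hb hn (by simpa using hab))
    push_cast
    field_simp
  · subst hn1
    refine isLUB_stDensitySet ha hb hn ?_
      (fun P hP => (area_packing_le_of_lt hb hba hh0 hha hP).1 hab)
      (exists_packing_area_three hb hba (sub_pos.2 hba) (by linarith) le_rfl)
    push_cast
    field_simp
  · subst hn1
    have hba : b < a := by linarith
    refine isLUB_stDensitySet ha hb hn (A := (a ^ 2 + 2 * b ^ 2) / 2) ?_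
      (fun P hP => (area_packing_le_of_lt hb hba hh0 hha hP).2 hab) ?_
    · push_cast
      field_simp
    · obtain ⟨P, hP, hA⟩ := exists_packing_area_three hb hba hb le_rfl (by linarith)
      exact ⟨P, hP, by rw [hA]; ring⟩
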